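/- (The lₙ are Koopman eigenfunctionals of the Burgers flow.) Let u₀ ∈ Ω_B and t > 0, and let u(t,·) = −2 ∂ₓv(t,·)/v(t,·) be the Burgers evolution of u₀. Then u(t,·) ∈ L²([0,1]) and for every integer n ≥ 1, lₙ(u(t,·)) = e^{−n²π²t} lₙ(u₀). -/

import Mathlib

open MeasureTheory Real Set

/-- The `L²([0,1])` norm of a real function. -/
noncomputable def L2norm (f : ℝ → ℝ) : ℝ := Real.sqrt (∫ s in (0:ℝ)..1, f s ^ 2)

/-- The Cole-Hopf transform `H`. -/
noncomputable def coleHopfH (u : ℝ → ℝ) : ℝ → ℝ := fun x =>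
  Real.exp (-(1/2) * ∫ s in (0:ℝ)..x, u s) /
    ∫ y in (0:ℝ)..1, Real.exp (-(1/2) * ∫ s in (0:ℝ)..y, u s)

/-- The cosine Fourier coefficient `cₙ(v) = √2 ∫₀¹ v(s) cos(nπs) ds`. -/
noncomputable def cCoef (n : ℕ) (v : ℝ → ℝ) : ℝ :=
  Real.sqrt 2 * ∫ s in (0:ℝ)..1, v s * Real.cos (n * π * s)

/-- `lₙ(u) = cₙ(H(u))`. -/
noncomputable def lCoef (n : ℕ) (u : ℝ → ℝ) : ℝ := cCoef n (coleHopfH u)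

/-- `u₀ ∈ Ω_B` : `u₀ ∈ L²([0,1])` with `2 e^{‖u₀‖} ‖u₀‖ < 1`. -/
def MemOmegaB (u₀ : ℝ → ℝ) : Prop :=
  IntervalIntegrable u₀ volume 0 1 ∧ IntervalIntegrable (fun s => u₀ s ^ 2) volume 0 1 ∧
    2 * Real.exp (L2norm u₀) * L2norm u₀ < 1

/-- The heat evolution `v(t,x) = 1 + Σ_{n≥1} e^{-n²π²t} lₙ(u₀) √2 cos(nπx)`. -/
noncomputable def heatV (u₀ : ℝ → ℝ) (t x : ℝ) : ℝ :=
  1 + ∑' n : ℕ+, Real.exp (-((n : ℕ) : ℝ) ^ 2 * π ^ 2 * t) * lCoef (n : ℕ) u₀ *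
    (Real.sqrt 2 * Real.cos (((n : ℕ) : ℝ) * π * x))

/-- The spatial derivative of the heat evolution,
`∂ₓv(t,x) = -Σ_{n≥1} e^{-n²π²t} lₙ(u₀) √2 nπ sin(nπx)`. -/
noncomputable def heatVx (u₀ : ℝ → ℝ) (t x : ℝ) : ℝ :=
  -∑' n : ℕ+, Real.exp (-((n : ℕ) : ℝ) ^ 2 * π ^ 2 * t) * lCoef (n : ℕ) u₀ *
    (Real.sqrt 2 * ((n : ℕ) : ℝ) * π * Real.sin (((n : ℕ) : ℝ) * π * x))

/-- The Burgers evolution `u(t,x) = -2 ∂ₓv(t,x) / v(t,x)`. -/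
noncomputable def burgersU (u₀ : ℝ → ℝ) (t x : ℝ) : ℝ := -2 * heatVx u₀ t x / heatV u₀ t x

/-- The Koopman index set `𝒜`: a tuple `ν = (n₀, n₁, …, n_{α(ν)})` of positive integers,
encoded as the head `n₀ : ℕ+` together with the (possibly empty) list `(n₁, …, n_{α(ν)})`. -/
abbrev KoopIdx : Type := ℕ+ × List ℕ+

/-- The Koopman eigenvalue `λ_ν = -π² Σ_{k=0}^{α(ν)} n_k²`. -/
noncomputable def lamIdx (ν : KoopIdx) : ℝ :=
  -π ^ 2 * ((((ν.1 : ℕ) : ℝ)) ^ 2 + (ν.2.map (fun k => (((k : ℕ) : ℝ)) ^ 2)).sum)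

/-- The Koopman mode
`a_ν(x) = (-1)^{α(ν)} 2^{(α(ν)+3)/2} n₀ π sin(n₀πx) ∏_{k=1}^{α(ν)} cos(n_kπx)`. -/
noncomputable def aIdx (ν : KoopIdx) (x : ℝ) : ℝ :=
  (-1 : ℝ) ^ ν.2.length * (2 : ℝ) ^ (((ν.2.length : ℝ) + 3) / 2) * ((ν.1 : ℕ) : ℝ) * π *
    Real.sin (((ν.1 : ℕ) : ℝ) * π * x) *
    (ν.2.map (fun k => Real.cos (((k : ℕ) : ℝ) * π * x))).prod

/-- The Koopman eigenfunctional `φ_ν(u₀) = ∏_{k=0}^{α(ν)} l_{n_k}(u₀)`. -/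
noncomputable def phiIdx (u₀ : ℝ → ℝ) (ν : KoopIdx) : ℝ :=
  lCoef (ν.1 : ℕ) u₀ * (ν.2.map (fun k => lCoef (k : ℕ) u₀)).prod


lemma int_cos_int (k : ℤ) : ∫ s in (0:ℝ)..1, Real.cos (k * π * s) = if k = 0 then 1 else 0 := by
  split_ifs with hk
  · simp [hk]
  · have hk' : (k : ℝ) * π ≠ 0 := by
      have : (k : ℝ) ≠ 0 := by exact_mod_cast hk
      positivity
    rw [intervalIntegral.integral_comp_mul_left (fun x => Real.cos x) hk']
    simp [Real.sin_int_mul_pi]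

lemma int_cos_cos (m n : ℕ) (hm : 1 ≤ m) (_hn : 1 ≤ n) :
    ∫ s in (0:ℝ)..1, Real.cos (m * π * s) * Real.cos (n * π * s) = if m = n then 1/2 else 0 := by
  have e : ∀ s : ℝ, Real.cos (m * π * s) * Real.cos (n * π * s) =
      (1/2) * Real.cos (((m - n : ℤ) : ℝ) * π * s) + (1/2) * Real.cos (((m + n : ℤ) : ℝ) * π * s) := by
    intro s
    push_cast
    rw [show ((m:ℝ) - n) * π * s = m * π * s - n * π * s by ring,
      show ((m:ℝ) + n) * π * s = m * π * s + n * π * s by ring, Real.cos_sub, Real.cos_add]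
    ring
  simp_rw [e]
  rw [intervalIntegral.integral_add (by apply Continuous.intervalIntegrable; fun_prop)
    (by apply Continuous.intervalIntegrable; fun_prop), intervalIntegral.integral_const_mul,
    intervalIntegral.integral_const_mul, int_cos_int, int_cos_int]
  have h2 : ¬ ((m:ℤ) + n = 0) := by omega
  rw [if_neg h2]
  by_cases h : m = n
  · simp [h]
  · have h3 : ¬ ((m:ℤ) - n = 0) := by omega
    simp [h, h3]

lemma int_sin_sin (m n : ℕ) (hm : 1 ≤ m) (_hn : 1 ≤ n) :
    ∫ s in (0:ℝ)..1, Real.sin (m * π * s) * Real.sin (n * π * s) = if m = n then 1/2 else 0 := by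
  have e : ∀ s : ℝ, Real.sin (m * π * s) * Real.sin (n * π * s) =
      (1/2) * Real.cos (((m - n : ℤ) : ℝ) * π * s) - (1/2) * Real.cos (((m + n : ℤ) : ℝ) * π * s) := by
    intro s
    push_cast
    rw [show ((m:ℝ) - n) * π * s = m * π * s - n * π * s by ring,
      show ((m:ℝ) + n) * π * s = m * π * s + n * π * s by ring, Real.cos_sub, Real.cos_add]
    ring
  simp_rw [e]
  rw [intervalIntegral.integral_sub (by apply Continuous.intervalIntegrable; fun_prop)
    (by apply Continuous.intervalIntegrable; fun_prop), intervalIntegral.integral_const_mul,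
    intervalIntegral.integral_const_mul, int_cos_int, int_cos_int]
  have h2 : ¬ ((m:ℤ) + n = 0) := by omega
  rw [if_neg h2]
  by_cases h : m = n
  · simp [h]
  · have h3 : ¬ ((m:ℤ) - n = 0) := by omega
    simp [h, h3]

lemma exp_lip {C a b : ℝ} (ha : a ≤ C) (hb : b ≤ C) :
    |Real.exp a - Real.exp b| ≤ Real.exp C * |a - b| := by
  have key : ∀ x y : ℝ, y ≤ x → x ≤ C → Real.exp x - Real.exp y ≤ Real.exp C * (x - y) := by
    intro x y hxy hx
    have h1 : y - x + 1 ≤ Real.exp (y - x) := Real.add_one_le_exp _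
    have h2 : Real.exp y = Real.exp x * Real.exp (y - x) := by rw [← Real.exp_add]; congr 1; ring
    have h3 : Real.exp x ≤ Real.exp C := Real.exp_le_exp.2 hx
    have h4 := Real.exp_pos x
    rw [h2]
    nlinarith
  rcases le_total b a with h | h
  · rw [abs_of_nonneg (by linarith [Real.exp_le_exp.2 h]), abs_of_nonneg (by linarith)]
    exact key a b h ha
  · rw [abs_sub_comm, abs_sub_comm a b, abs_of_nonneg (by linarith [Real.exp_le_exp.2 h]),
      abs_of_nonneg (by linarith)]
    exact key b a h hb

lemma ac_exp {f : ℝ → ℝ} {a b : ℝ} (hf : AbsolutelyContinuousOnInterval f a b) :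
    AbsolutelyContinuousOnInterval (fun x => Real.exp (f x)) a b := by
  obtain ⟨C, hC⟩ := hf.exists_bound
  have h0 := Filter.Tendsto.const_mul (Real.exp C) hf
  rw [mul_zero] at h0
  refine squeeze_zero' (Filter.Eventually.of_forall fun E => Finset.sum_nonneg fun _ _ => dist_nonneg)
    ?_ h0
  filter_upwards [Filter.mem_inf_of_right (Filter.mem_principal_self _)] with E hE
  rw [Finset.mul_sum]
  refine Finset.sum_le_sum fun i hi => ?_
  have := hE.1 i hi
  rw [Real.dist_eq, Real.dist_eq]
  exact exp_lip ((le_abs_self _).trans (hC _ this.1)) ((le_abs_self _).trans (hC _ this.2))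

/-- the unnormalised Cole-Hopf transform -/
noncomputable def chW (u : ℝ → ℝ) (x : ℝ) : ℝ := Real.exp (-(1/2) * ∫ s in (0:ℝ)..x, u s)

lemma chW_ac {u : ℝ → ℝ} (hu : IntervalIntegrable u volume 0 1) :
    AbsolutelyContinuousOnInterval (chW u) 0 1 :=
  ac_exp ((hu.absolutelyContinuousOnInterval_intervalIntegral (c := 0) (by simp)).const_mul (-(1/2)))

lemma chW_deriv {u : ℝ → ℝ} (hu : IntervalIntegrable u volume 0 1) :
    ∀ᵐ x, x ∈ uIcc (0:ℝ) 1 → deriv (chW u) x = -(1/2) * (u x * chW u x) := by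
  filter_upwards [hu.ae_hasDerivAt_integral] with x hx hx'
  have h1 := ((hx hx' 0 (by simp)).const_mul (-(1/2))).exp
  rw [show chW u = fun x => Real.exp (-(1/2) * ∫ s in (0:ℝ)..x, u s) from rfl, h1.deriv]
  ring

lemma chW_ibp {u : ℝ → ℝ} (hu : IntervalIntegrable u volume 0 1) (n : ℕ) (hn : 1 ≤ n) :
    ∫ s in (0:ℝ)..1, chW u s * Real.cos (n * π * s) =
      1 / (2 * (n * π)) * ∫ s in (0:ℝ)..1, u s * chW u s * Real.sin (n * π * s) := by
  have hn0 : (n : ℝ) * π ≠ 0 := by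
    have : (n : ℝ) ≠ 0 := by exact_mod_cast (by omega : n ≠ 0)
    positivity
  have hg : AbsolutelyContinuousOnInterval (fun s : ℝ => Real.sin (n * π * s) / (n * π)) 0 1 := by
    apply ContDiffOn.absolutelyContinuousOnInterval
    apply ContDiff.contDiffOn
    fun_prop
  have hd : ∀ s : ℝ, deriv (fun s : ℝ => Real.sin (n * π * s) / (n * π)) s = Real.cos (n * π * s) := by
    intro s
    have h1 := ((((hasDerivAt_id s).const_mul (n * π)).sin).div_const (n * π))
    simp only [id] at h1
    rw [h1.deriv]
    field_simp
  have := (chW_ac hu).integral_mul_deriv_eq_deriv_mul hg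
  simp_rw [hd] at this
  rw [this]
  have e : ∫ x in (0:ℝ)..1, deriv (chW u) x * (Real.sin (n * π * x) / (n * π)) =
      ∫ x in (0:ℝ)..1, -(1 / (2 * (n * π))) * (u x * chW u x * Real.sin (n * π * x)) := by
    apply intervalIntegral.integral_congr_ae
    filter_upwards [chW_deriv hu] with x hx hx'
    rw [hx (uIoc_subset_uIcc hx')]
    field_simp
  rw [e, intervalIntegral.integral_const_mul]
  simp [Real.sin_nat_mul_pi]

lemma abs_int_le {u : ℝ → ℝ} (hu : IntervalIntegrable u volume 0 1)
    (hu2 : IntervalIntegrable (fun s => u s ^ 2) volume 0 1) {x : ℝ} (hx : x ∈ Icc (0:ℝ) 1) :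
    |∫ s in (0:ℝ)..x, u s| ≤ L2norm u := by
  have h1 : |∫ s in (0:ℝ)..x, u s| ≤ ∫ s in (0:ℝ)..1, |u s| := by
    refine (intervalIntegral.abs_integral_le_integral_abs hx.1).trans ?_
    refine intervalIntegral.integral_mono_interval le_rfl hx.1 hx.2 ?_ hu.abs
    exact Filter.Eventually.of_forall fun _ => abs_nonneg _
  refine h1.trans (Real.le_sqrt_of_sq_le ?_)
  set A := ∫ s in (0:ℝ)..1, |u s| with hA
  have h2 : 0 ≤ ∫ s in (0:ℝ)..1, (|u s| - A) ^ 2 :=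
    intervalIntegral.integral_nonneg zero_le_one fun _ _ => sq_nonneg _
  have h3 : ∀ s, (|u s| - A) ^ 2 = u s ^ 2 - (2 * A) * |u s| + A ^ 2 := by
    intro s; rw [← sq_abs (u s)]; ring
  simp_rw [h3] at h2
  rw [intervalIntegral.integral_add (hu2.sub (hu.abs.const_mul _)) (by simp),
    intervalIntegral.integral_sub hu2 (hu.abs.const_mul _), intervalIntegral.integral_const_mul,
    ← hA] at h2
  simp at h2
  nlinarith

lemma chW_cont {u : ℝ → ℝ} (hu : IntervalIntegrable u volume 0 1) :
    ContinuousOn (chW u) (uIcc 0 1) := (chW_ac hu).continuousOn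

lemma coleHopf_le {u : ℝ → ℝ} (hu : IntervalIntegrable u volume 0 1)
    (hu2 : IntervalIntegrable (fun s => u s ^ 2) volume 0 1) {x : ℝ} (hx : x ∈ Icc (0:ℝ) 1) :
    0 ≤ coleHopfH u x ∧ coleHopfH u x ≤ Real.exp (L2norm u) := by
  set N := L2norm u
  have hZ : Real.exp (-N/2) ≤ ∫ y in (0:ℝ)..1, chW u y := by
    have : ∫ y in (0:ℝ)..1, Real.exp (-N/2) ≤ ∫ y in (0:ℝ)..1, chW u y := by
      refine intervalIntegral.integral_mono_on zero_le_one (by simp)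
        (chW_cont hu).intervalIntegrable ?_
      intro y hy
      refine Real.exp_le_exp.2 ?_
      have := (abs_le.1 (abs_int_le hu hu2 hy)).2
      linarith
    simpa using this
  have hZ0 : 0 < ∫ y in (0:ℝ)..1, chW u y := (Real.exp_pos _).trans_le hZ
  have hW : chW u x ≤ Real.exp (N/2) := by
    refine Real.exp_le_exp.2 ?_
    have := (abs_le.1 (abs_int_le hu hu2 hx)).1
    linarith
  show 0 ≤ chW u x / (∫ y in (0:ℝ)..1, chW u y) ∧ chW u x / (∫ y in (0:ℝ)..1, chW u y) ≤ _
  refine ⟨div_nonneg (Real.exp_pos _).le hZ0.le, ?_⟩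
  rw [div_le_iff₀ hZ0]
  refine hW.trans ?_
  calc Real.exp (N/2) = Real.exp N * Real.exp (-N/2) := by rw [← Real.exp_add]; congr 1; ring
    _ ≤ _ := by gcongr

lemma lCoef_eq {u : ℝ → ℝ} (hu : IntervalIntegrable u volume 0 1) (n : ℕ) (hn : 1 ≤ n) :
    Real.sqrt 2 * lCoef n u =
      1 / (n * π) * ∫ s in (0:ℝ)..1, u s * coleHopfH u s * Real.sin (n * π * s) := by
  have h2 : Real.sqrt 2 * Real.sqrt 2 = 2 := Real.mul_self_sqrt (by norm_num)
  have e1 : ∫ s in (0:ℝ)..1, coleHopfH u s * Real.cos (n * π * s) =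
      (∫ y in (0:ℝ)..1, chW u y)⁻¹ * ∫ s in (0:ℝ)..1, chW u s * Real.cos (n * π * s) := by
    rw [← intervalIntegral.integral_const_mul]
    congr 1; ext s
    show chW u s / (∫ y in (0:ℝ)..1, chW u y) * _ = _
    ring
  have e2 : ∫ s in (0:ℝ)..1, u s * coleHopfH u s * Real.sin (n * π * s) =
      (∫ y in (0:ℝ)..1, chW u y)⁻¹ * ∫ s in (0:ℝ)..1, u s * chW u s * Real.sin (n * π * s) := by
    rw [← intervalIntegral.integral_const_mul]
    congr 1; ext s
    show u s * (chW u s / (∫ y in (0:ℝ)..1, chW u y)) * _ = _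
    ring
  rw [lCoef, cCoef, e1, e2, chW_ibp hu n hn, ← mul_assoc, h2]
  have : (1:ℝ) / (2 * (n * π)) = (1/2) * (1 / (n * π)) := by
    rw [one_div_mul_one_div]
  rw [this]
  ring

lemma int_g_sq (F : Finset ℕ+) (a : ℕ+ → ℝ) :
    ∫ s in (0:ℝ)..1, (∑ n ∈ F, a n * Real.sin ((n : ℕ) * π * s)) ^ 2 = ∑ n ∈ F, a n ^ 2 / 2 := by
  have e : ∀ s : ℝ, (∑ n ∈ F, a n * Real.sin ((n : ℕ) * π * s)) ^ 2 =
      ∑ n ∈ F, ∑ m ∈ F, (a n * a m) * (Real.sin ((n : ℕ) * π * s) * Real.sin ((m : ℕ) * π * s)) := by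
    intro s
    rw [sq, Finset.sum_mul_sum]
    refine Finset.sum_congr rfl fun n _ => Finset.sum_congr rfl fun m _ => by ring
  simp_rw [e]
  rw [intervalIntegral.integral_finsetSum
    (fun i _ => by apply Continuous.intervalIntegrable; fun_prop)]
  refine Finset.sum_congr rfl fun n hn => ?_
  rw [intervalIntegral.integral_finsetSum
    (fun i _ => by apply Continuous.intervalIntegrable; fun_prop)]
  simp_rw [intervalIntegral.integral_const_mul]
  rw [Finset.sum_eq_single n]
  · rw [int_sin_sin (n : ℕ) (n : ℕ) (one_le (a := n)) (one_le (a := n))]; simp; ring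
  · intro m _ hmn
    rw [int_sin_sin (n : ℕ) (m : ℕ) (one_le (a := n)) (one_le (a := m)), if_neg (fun h => hmn (PNat.coe_injective h.symm)), mul_zero]
  · intro h; exact absurd hn h

lemma sum_inv_sq (F : Finset ℕ+) : ∑ n ∈ F, (1 / (((n : ℕ) : ℝ) * π)) ^ 2 ≤ 1 / 6 := by
  have h1 : ∑ n ∈ F, (1 / ((n : ℕ) : ℝ) ^ 2) ≤ π ^ 2 / 6 := by
    have h := hasSum_zeta_two
    have h2 : ∑ n ∈ F, (1 / ((n : ℕ) : ℝ) ^ 2) =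
        ∑ k ∈ F.map ⟨fun n : ℕ+ => (n : ℕ), PNat.coe_injective⟩, (1 / (k : ℝ) ^ 2) := by
      rw [Finset.sum_map]; rfl
    rw [h2]
    exact sum_le_hasSum _ (fun i _ => by positivity) h
  have h3 : ∀ n : ℕ+, (1 / (((n : ℕ) : ℝ) * π)) ^ 2 = (1 / π ^ 2) * (1 / ((n : ℕ) : ℝ) ^ 2) := by
    intro n; rw [one_div_mul_one_div, div_pow, mul_pow]; ring
  simp_rw [h3]
  rw [← Finset.mul_sum]
  calc _ ≤ 1 / π ^ 2 * (π ^ 2 / 6) := by gcongr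
    _ = 1/6 := by have := Real.pi_ne_zero; field_simp

lemma partial_bound {u : ℝ → ℝ} (h : MemOmegaB u) (F : Finset ℕ+) (a : ℕ+ → ℝ)
    (ha : ∀ n, |a n| ≤ 1) : |∑ n ∈ F, a n * (Real.sqrt 2 * lCoef n u)| ≤ 1 / 2 := by
  obtain ⟨hu, hu2, hN⟩ := h
  set f : ℝ → ℝ := fun s => u s * coleHopfH u s with hf
  have hcont : ContinuousOn (coleHopfH u) (uIcc 0 1) := (chW_cont hu).div_const _
  have hfi : IntervalIntegrable f volume 0 1 := hu.mul_continuousOn hcont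
  have hf2 : IntervalIntegrable (fun s => f s ^ 2) volume 0 1 := by
    have := hu2.mul_continuousOn (hcont.pow 2)
    simpa only [hf, mul_pow, Pi.pow_apply] using this
  have hN0 : 0 ≤ L2norm u := Real.sqrt_nonneg _
  have hNsq : L2norm u ^ 2 = ∫ s in (0:ℝ)..1, u s ^ 2 :=
    Real.sq_sqrt (intervalIntegral.integral_nonneg zero_le_one fun _ _ => sq_nonneg _)
  have hfb : ∫ s in (0:ℝ)..1, f s ^ 2 ≤ 1 / 4 := by
    calc ∫ s in (0:ℝ)..1, f s ^ 2 ≤ ∫ s in (0:ℝ)..1, Real.exp (L2norm u) ^ 2 * u s ^ 2 := by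
          refine intervalIntegral.integral_mono_on zero_le_one hf2 (hu2.const_mul _) ?_
          intro s hs
          obtain ⟨h0, h1⟩ := coleHopf_le hu hu2 hs
          simp only [hf, mul_pow]
          rw [mul_comm]
          gcongr
      _ = (Real.exp (L2norm u) * L2norm u) ^ 2 := by
          rw [intervalIntegral.integral_const_mul, ← hNsq, mul_pow]
      _ ≤ (1/2) ^ 2 := by
          have := Real.exp_pos (L2norm u)
          gcongr
          linarith
      _ = 1/4 := by norm_num
  set b : ℕ+ → ℝ := fun n => a n * (1 / (((n : ℕ) : ℝ) * π)) with hb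
  set g : ℝ → ℝ := fun s => ∑ n ∈ F, b n * Real.sin ((n : ℕ) * π * s) with hg
  have hgc : Continuous g := by fun_prop
  have hsum : ∑ n ∈ F, a n * (Real.sqrt 2 * lCoef n u) = ∫ s in (0:ℝ)..1, f s * g s := by
    simp only [hg, Finset.mul_sum]
    rw [intervalIntegral.integral_finsetSum]
    · refine Finset.sum_congr rfl fun n _ => ?_
      rw [lCoef_eq hu n n.2, ← mul_assoc, ← intervalIntegral.integral_const_mul]
      congr 1; ext s
      simp only [hf, hb]; ring
    · intro n _
      exact hfi.mul_continuousOn (by fun_prop)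
  have hgb : ∫ s in (0:ℝ)..1, g s ^ 2 ≤ 1 / 12 := by
    rw [int_g_sq, ← Finset.sum_div]
    have : ∑ n ∈ F, b n ^ 2 ≤ ∑ n ∈ F, (1 / (((n : ℕ) : ℝ) * π)) ^ 2 := by
      refine Finset.sum_le_sum fun n _ => ?_
      simp only [hb, mul_pow]
      have h1 : a n ^ 2 ≤ 1 := by rw [← sq_abs]; exact pow_le_one₀ (abs_nonneg _) (ha n)
      exact mul_le_of_le_one_left (by positivity) h1
    linarith [sum_inv_sq F]
  have hg2 : IntervalIntegrable (fun s => g s ^ 2) volume 0 1 :=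
    (hgc.pow 2).intervalIntegrable _ _
  have hfg : IntervalIntegrable (fun s => f s * g s) volume 0 1 :=
    hfi.mul_continuousOn hgc.continuousOn
  rw [hsum]
  calc |∫ s in (0:ℝ)..1, f s * g s| ≤ ∫ s in (0:ℝ)..1, |f s * g s| :=
        intervalIntegral.abs_integral_le_integral_abs zero_le_one
    _ ≤ ∫ s in (0:ℝ)..1, (f s ^ 2 + g s ^ 2) := by
        refine intervalIntegral.integral_mono_on zero_le_one hfg.abs (hf2.add hg2) ?_
        intro s _
        rw [abs_mul, ← sq_abs (f s), ← sq_abs (g s)]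
        nlinarith [sq_nonneg (|f s| - |g s|), sq_nonneg (|f s|), sq_nonneg (|g s|)]
    _ = (∫ s in (0:ℝ)..1, f s ^ 2) + ∫ s in (0:ℝ)..1, g s ^ 2 :=
        intervalIntegral.integral_add hf2 hg2
    _ ≤ 1/2 := by linarith

lemma lCoef_bound {u : ℝ → ℝ} (h : MemOmegaB u) (n : ℕ+) : |Real.sqrt 2 * lCoef n u| ≤ 1 := by
  have := partial_bound h {n} (fun _ => 1) (by simp)
  simp only [Finset.sum_singleton, one_mul] at this
  linarith

lemma summable_B (t : ℝ) (ht : 0 < t) :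
    Summable fun n : ℕ+ => Real.exp (-((n : ℕ) : ℝ) ^ 2 * π ^ 2 * t) * (((n : ℕ) : ℝ) * π) := by
  have hr : 0 < π ^ 2 * t := by positivity
  have h0 := ((Real.summable_pow_mul_exp_neg_nat_mul 1 hr).mul_left π).comp_injective
    PNat.coe_injective
  refine Summable.of_nonneg_of_le (fun n => by positivity) (fun n => ?_) h0
  have hn : (1:ℝ) ≤ (n : ℕ) := by exact_mod_cast (one_le (a := n))
  have : Real.exp (-((n : ℕ) : ℝ) ^ 2 * π ^ 2 * t) ≤ Real.exp (-(π ^ 2 * t) * (n : ℕ)) := by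
    apply Real.exp_le_exp.2
    nlinarith [mul_nonneg hr.le (by nlinarith : (0:ℝ) ≤ ((n : ℕ) : ℝ) ^ 2 - (n : ℕ))]
  simp only [Function.comp, pow_one]
  calc _ ≤ Real.exp (-(π ^ 2 * t) * (n : ℕ)) * (((n : ℕ) : ℝ) * π) := by gcongr
    _ = _ := by ring

lemma heatV_term_bound {u : ℝ → ℝ} (h : MemOmegaB u) (t : ℝ) (n : ℕ+) (x : ℝ) :
    ‖Real.exp (-((n : ℕ) : ℝ) ^ 2 * π ^ 2 * t) * lCoef (n : ℕ) u *
      (Real.sqrt 2 * Real.cos (((n : ℕ) : ℝ) * π * x))‖ ≤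
    Real.exp (-((n : ℕ) : ℝ) ^ 2 * π ^ 2 * t) * (((n : ℕ) : ℝ) * π) := by
  have e : Real.exp (-((n : ℕ) : ℝ) ^ 2 * π ^ 2 * t) * lCoef (n : ℕ) u *
      (Real.sqrt 2 * Real.cos (((n : ℕ) : ℝ) * π * x)) =
      Real.exp (-((n : ℕ) : ℝ) ^ 2 * π ^ 2 * t) * ((Real.sqrt 2 * lCoef (n : ℕ) u) *
      Real.cos (((n : ℕ) : ℝ) * π * x)) := by ring
  rw [e, norm_mul, norm_mul, Real.norm_eq_abs, Real.norm_eq_abs, Real.norm_eq_abs, Real.abs_exp]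
  have hn : (1:ℝ) ≤ (n : ℕ) := by exact_mod_cast (one_le (a := n))
  have hp : 1 ≤ ((n : ℕ) : ℝ) * π := by nlinarith [Real.pi_gt_three]
  refine mul_le_mul_of_nonneg_left ?_ (Real.exp_pos _).le
  exact (mul_le_one₀ (lCoef_bound h n) (abs_nonneg _) (Real.abs_cos_le_one _)).trans hp

lemma heatVx_term_bound {u : ℝ → ℝ} (h : MemOmegaB u) (t : ℝ) (n : ℕ+) (x : ℝ) :
    ‖Real.exp (-((n : ℕ) : ℝ) ^ 2 * π ^ 2 * t) * lCoef (n : ℕ) u *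
      (Real.sqrt 2 * ((n : ℕ) : ℝ) * π * Real.sin (((n : ℕ) : ℝ) * π * x))‖ ≤
    Real.exp (-((n : ℕ) : ℝ) ^ 2 * π ^ 2 * t) * (((n : ℕ) : ℝ) * π) := by
  have e : Real.exp (-((n : ℕ) : ℝ) ^ 2 * π ^ 2 * t) * lCoef (n : ℕ) u *
      (Real.sqrt 2 * ((n : ℕ) : ℝ) * π * Real.sin (((n : ℕ) : ℝ) * π * x)) =
      (Real.exp (-((n : ℕ) : ℝ) ^ 2 * π ^ 2 * t) * (((n : ℕ) : ℝ) * π)) *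
       ((Real.sqrt 2 * lCoef (n : ℕ) u) * Real.sin (((n : ℕ) : ℝ) * π * x)) := by ring
  rw [e, norm_mul, Real.norm_of_nonneg (by positivity), norm_mul, Real.norm_eq_abs, Real.norm_eq_abs]
  exact mul_le_of_le_one_right (by positivity)
    (mul_le_one₀ (lCoef_bound h n) (abs_nonneg _) (Real.abs_sin_le_one _))

lemma heatV_summable {u : ℝ → ℝ} (h : MemOmegaB u) (t : ℝ) (ht : 0 < t) (x : ℝ) :
    Summable fun n : ℕ+ => Real.exp (-((n : ℕ) : ℝ) ^ 2 * π ^ 2 * t) * lCoef (n : ℕ) u *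
      (Real.sqrt 2 * Real.cos (((n : ℕ) : ℝ) * π * x)) :=
  Summable.of_norm_bounded (summable_B t ht) fun n => heatV_term_bound h t n x

lemma heatV_cont {u : ℝ → ℝ} (h : MemOmegaB u) (t : ℝ) (ht : 0 < t) :
    Continuous (heatV u t) := by
  unfold heatV
  exact continuous_const.add (continuous_tsum (fun n => by fun_prop) (summable_B t ht)
    fun n x => heatV_term_bound h t n x)

lemma heatVx_cont {u : ℝ → ℝ} (h : MemOmegaB u) (t : ℝ) (ht : 0 < t) :
    Continuous (heatVx u t) := by
  unfold heatVx
  exact (continuous_tsum (fun n => by fun_prop) (summable_B t ht)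
    fun n x => heatVx_term_bound h t n x).neg

lemma heatV_deriv {u : ℝ → ℝ} (h : MemOmegaB u) (t : ℝ) (ht : 0 < t) (x : ℝ) :
    HasDerivAt (heatV u t) (heatVx u t x) x := by
  unfold heatV heatVx
  rw [← tsum_neg]
  refine HasDerivAt.const_add _ ?_
  have hd : ∀ (n : ℕ+) (y : ℝ), HasDerivAt (fun x : ℝ =>
      Real.exp (-((n : ℕ) : ℝ) ^ 2 * π ^ 2 * t) * lCoef (n : ℕ) u *
      (Real.sqrt 2 * Real.cos (((n : ℕ) : ℝ) * π * x)))
      (-(Real.exp (-((n : ℕ) : ℝ) ^ 2 * π ^ 2 * t) * lCoef (n : ℕ) u *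
      (Real.sqrt 2 * ((n : ℕ) : ℝ) * π * Real.sin (((n : ℕ) : ℝ) * π * y)))) y := by
    intro n y
    generalize Real.exp (-((n : ℕ) : ℝ) ^ 2 * π ^ 2 * t) * lCoef (n : ℕ) u = E
    have h1 := ((((hasDerivAt_id y).const_mul (((n : ℕ) : ℝ) * π)).cos).const_mul
      (Real.sqrt 2)).const_mul E
    simp only [id] at h1
    refine h1.congr_deriv ?_
    ring
  refine hasDerivAt_tsum (summable_B t ht) hd (fun n y => ?_)
    (heatV_summable h t ht 0) x
  rw [norm_neg]; exact heatVx_term_bound h t n y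

lemma heatV_pos {u : ℝ → ℝ} (h : MemOmegaB u) (t : ℝ) (ht : 0 < t) (x : ℝ) :
    0 < heatV u t x := by
  have hs := (heatV_summable h t ht x).hasSum
  have hle : -(1/2) ≤ ∑' n : ℕ+, Real.exp (-((n : ℕ) : ℝ) ^ 2 * π ^ 2 * t) * lCoef (n : ℕ) u *
      (Real.sqrt 2 * Real.cos (((n : ℕ) : ℝ) * π * x)) := by
    refine ge_of_tendsto' hs fun F => ?_
    have := partial_bound h F (fun n => Real.exp (-((n : ℕ) : ℝ) ^ 2 * π ^ 2 * t) *
      Real.cos (((n : ℕ) : ℝ) * π * x)) (fun n => ?_)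
    · refine (abs_le.1 this).1.trans (le_of_eq ?_)
      exact Finset.sum_congr rfl fun n _ => by ring
    · rw [abs_mul, Real.abs_exp]
      refine mul_le_one₀ (Real.exp_le_one_iff.2 ?_) (abs_nonneg _) (Real.abs_cos_le_one _)
      have : 0 ≤ ((n : ℕ) : ℝ) ^ 2 * π ^ 2 * t := by positivity
      linarith
  unfold heatV
  linarith

/-- termwise integration against a cosine -/
lemma heatV_hasSum {u : ℝ → ℝ} (h : MemOmegaB u) (t : ℝ) (ht : 0 < t) (k : ℕ) :
    HasSum (fun n : ℕ+ => Real.exp (-((n : ℕ) : ℝ) ^ 2 * π ^ 2 * t) * lCoef (n : ℕ) u * Real.sqrt 2 *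
      ∫ x in (0:ℝ)..1, Real.cos (((n : ℕ) : ℝ) * π * x) * Real.cos (k * π * x))
      (∫ x in (0:ℝ)..1, (heatV u t x - 1) * Real.cos (k * π * x)) := by
  simp_rw [← intervalIntegral.integral_const_mul]
  refine intervalIntegral.hasSum_integral_of_dominated_convergence
    (fun n _ => Real.exp (-((n : ℕ) : ℝ) ^ 2 * π ^ 2 * t) * (((n : ℕ) : ℝ) * π))
    (fun n => Continuous.aestronglyMeasurable (by fun_prop)) (fun n => ?_) ?_ (by simp) ?_
  · refine Filter.Eventually.of_forall fun x _ => ?_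
    have h1 := heatV_term_bound h t n x
    rw [← mul_assoc, mul_assoc _ (Real.sqrt 2), norm_mul, Real.norm_eq_abs (Real.cos (k * π * x))]
    exact (mul_le_of_le_one_right (norm_nonneg _) (Real.abs_cos_le_one _)).trans h1
  · exact Filter.Eventually.of_forall fun x _ => summable_B t ht
  · refine Filter.Eventually.of_forall fun x _ => ?_
    have h1 := (heatV_summable h t ht x).hasSum.mul_right (Real.cos (k * π * x))
    unfold heatV
    rw [add_sub_cancel_left]
    have e : ∀ n : ℕ+, Real.exp (-((n : ℕ) : ℝ) ^ 2 * π ^ 2 * t) * lCoef (n : ℕ) u *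
        (Real.sqrt 2 * Real.cos (((n : ℕ) : ℝ) * π * x)) * Real.cos (k * π * x) =
        Real.exp (-((n : ℕ) : ℝ) ^ 2 * π ^ 2 * t) * lCoef (n : ℕ) u * Real.sqrt 2 *
        (Real.cos (((n : ℕ) : ℝ) * π * x) * Real.cos (k * π * x)) := fun n => by ring
    simp_rw [e] at h1
    exact h1

lemma heatV_integral {u : ℝ → ℝ} (h : MemOmegaB u) (t : ℝ) (ht : 0 < t) :
    ∫ x in (0:ℝ)..1, heatV u t x = 1 := by
  have h1 := heatV_hasSum h t ht 0
  have h2 : ∀ n : ℕ+, ∫ x in (0:ℝ)..1, Real.cos (((n : ℕ) : ℝ) * π * x) = 0 := by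
    intro n
    have := int_cos_int (n : ℕ)
    simpa using this
  simp [h2] at h1
  have h3 := h1.unique hasSum_zero
  rw [intervalIntegral.integral_sub ((heatV_cont h t ht).intervalIntegrable _ _) (by simp)] at h3
  simp at h3
  linarith

lemma heatV_coef {u : ℝ → ℝ} (h : MemOmegaB u) (t : ℝ) (ht : 0 < t) (k : ℕ) (hk : 1 ≤ k) :
    cCoef k (heatV u t) = Real.exp (-(k : ℝ) ^ 2 * π ^ 2 * t) * lCoef k u := by
  obtain ⟨p, rfl⟩ : ∃ p : ℕ+, (p : ℕ) = k := ⟨k.toPNat hk, rfl⟩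
  have h1 := heatV_hasSum h t ht p
  have h2 := h1.unique (hasSum_single p (fun n hn => by
    rw [int_cos_cos (n : ℕ) p (one_le (a := n)) hk,
      if_neg (fun h => hn (PNat.coe_injective h)), mul_zero]))
  have h3 : ∫ x in (0:ℝ)..1, Real.cos ((p : ℕ) * π * x) = 0 := by
    have := int_cos_int (p : ℕ)
    rw [if_neg (by omega)] at this
    simpa using this
  have hcc : Continuous fun x : ℝ => Real.cos ((p : ℕ) * π * x) := by fun_prop
  simp_rw [sub_mul, one_mul] at h2
  rw [intervalIntegral.integral_sub
    (Continuous.intervalIntegrable (by have := heatV_cont h t ht; fun_prop) _ _) (hcc.intervalIntegrable _ _), h3,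
    sub_zero] at h2
  rw [cCoef, h2]
  rw [int_cos_cos p p hk hk, if_pos rfl]
  have hsq : Real.sqrt 2 * Real.sqrt 2 = 2 := Real.mul_self_sqrt (by norm_num)
  linear_combination (Real.exp (-((p : ℕ) : ℝ) ^ 2 * π ^ 2 * t) * lCoef p u / 2) * hsq

/-- **The `lₙ` are Koopman eigenfunctionals of the Burgers flow.** For
`u₀ ∈ Ω_B` and `t > 0`, the Burgers evolution `u(t,·)` of `u₀` belongs to `L²([0,1])` and
`lₙ(u(t,·)) = e^{-n²π²t} lₙ(u₀)` for every `n ≥ 1`. -/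
theorem lCoef_koopman_eigenfunctional (u₀ : ℝ → ℝ) (h : MemOmegaB u₀) (t : ℝ) (ht : 0 < t) :
    IntervalIntegrable (fun x => burgersU u₀ t x) volume 0 1 ∧
    IntervalIntegrable (fun x => burgersU u₀ t x ^ 2) volume 0 1 ∧
    ∀ n : ℕ, 1 ≤ n →
      lCoef n (fun x => burgersU u₀ t x) =
        Real.exp (-(n : ℝ) ^ 2 * π ^ 2 * t) * lCoef n u₀ := by
  have hc := heatV_cont h t ht
  have hcx := heatVx_cont h t ht
  have hcu : Continuous (fun x => burgersU u₀ t x) :=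
    (continuous_const.mul hcx).div hc fun x => (heatV_pos h t ht x).ne'
  refine ⟨hcu.intervalIntegrable _ _, (hcu.pow 2).intervalIntegrable _ _, fun n hn => ?_⟩
  have hH : coleHopfH (fun x => burgersU u₀ t x) = heatV u₀ t := by
    have hI : ∀ x, Real.exp (-(1/2) * ∫ s in (0:ℝ)..x, burgersU u₀ t s) =
        heatV u₀ t x / heatV u₀ t 0 := by
      intro x
      have h1 : ∫ s in (0:ℝ)..x, burgersU u₀ t s =
          -2 * Real.log (heatV u₀ t x) - -2 * Real.log (heatV u₀ t 0) := by
        refine intervalIntegral.integral_eq_sub_of_hasDerivAt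
          (f := fun s => -2 * Real.log (heatV u₀ t s)) (fun s _ => ?_) (hcu.intervalIntegrable _ _)
        have := ((heatV_deriv h t ht s).log (heatV_pos h t ht s).ne').const_mul (-2)
        rw [burgersU, mul_div_assoc]
        exact this
      rw [h1, show -(1/2) * (-2 * Real.log (heatV u₀ t x) - -2 * Real.log (heatV u₀ t 0)) =
        Real.log (heatV u₀ t x) - Real.log (heatV u₀ t 0) by ring, Real.exp_sub,
        Real.exp_log (heatV_pos h t ht x), Real.exp_log (heatV_pos h t ht 0)]
    ext x
    rw [coleHopfH]
    simp_rw [hI]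
    rw [intervalIntegral.integral_div, heatV_integral h t ht]
    have := (heatV_pos h t ht 0).ne'
    field_simp
  rw [lCoef, hH, heatV_coef h t ht n hn]
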